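/- Let p ≥ 7 be a prime. Let a_i, b_i (i = 1,…,9) be nonzero elements of the field ZMod p such that for every i, a_i + b_i ∈ {1, −1, 7, −7}. Assume: (i) Σ_{i=1}^9 (a_i b_i)⁻¹ = 30⁻¹; (ii) Σ_{i=1}^9 (a_i + b_i)² (a_i b_i)⁻¹ = 30⁻¹; and (iii) for every index i₀ with a_{i₀} + b_{i₀} ∈ {1, −1}, one has (b_{i₀} − a_{i₀})² (a_{i₀} b_{i₀})⁻¹ + Σ_{i ≠ i₀} (a_i b_i)⁻¹ = 30⁻¹. Then these conditions are contradictory (False). -/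

import Mathlib

open Finset

theorem ZMod.natCast_ne_zero_of_pos_of_lt {p n : ℕ} (hn : 0 < n) (hnp : n < p) :
    (n : ZMod p) ≠ 0 := by
  rw [Ne, ZMod.natCast_eq_zero_iff]
  exact Nat.not_dvd_of_pos_of_lt hn hnp

/-- Arithmetic core of Theorem B: the untwisted G-signature congruences (i),
(ii) together with the twisted congruence (iii), for nine pairs of nonzero
rotation numbers mod `p` with `aᵢ + bᵢ ≡ ±1` or `±7`, are contradictory. -/
theorem stmt10 (p : ℕ) (hp : p.Prime) (hp7 : 7 ≤ p)
    (a b : Fin 9 → ZMod p) (ha : ∀ i, a i ≠ 0) (hb : ∀ i, b i ≠ 0)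
    (hsum : ∀ i, a i + b i = 1 ∨ a i + b i = -1 ∨ a i + b i = 7 ∨ a i + b i = -7)
    (h1 : ∑ i, (a i * b i)⁻¹ = (30 : ZMod p)⁻¹)
    (h2 : ∑ i, (a i + b i) ^ 2 * (a i * b i)⁻¹ = (30 : ZMod p)⁻¹)
    (h3 : ∀ i₀, (a i₀ + b i₀ = 1 ∨ a i₀ + b i₀ = -1) →
      (b i₀ - a i₀) ^ 2 * (a i₀ * b i₀)⁻¹
        + ∑ i ∈ Finset.univ.erase i₀, (a i * b i)⁻¹ = (30 : ZMod p)⁻¹) :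
    False := by
  have : Fact p.Prime := ⟨hp⟩
  have two_ne : (2 : ZMod p) ≠ 0 :=
    mod_cast ZMod.natCast_ne_zero_of_pos_of_lt (n := 2) two_pos (by lia)
  have three_ne : (3 : ZMod p) ≠ 0 :=
    mod_cast ZMod.natCast_ne_zero_of_pos_of_lt (n := 3) three_pos (by lia)
  have five_ne : (5 : ZMod p) ≠ 0 :=
    mod_cast ZMod.natCast_ne_zero_of_pos_of_lt (n := 5) (by lia) (by lia)
  have thirty_ne : (30 : ZMod p) ≠ 0 := by
    rw [show (30 : ZMod p) = 2 * 3 * 5 by norm_num]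
    exact mul_ne_zero (mul_ne_zero two_ne three_ne) five_ne
  have not_unit_sum : ∀ i, ¬(a i + b i = 1 ∨ a i + b i = -1) := by
    intro i hi
    have hsq : (a i + b i) ^ 2 = 1 := by
      rcases hi with h | h <;> rw [h] <;> norm_num
    have hinv : a i * b i * (a i * b i)⁻¹ = 1 :=
      mul_inv_cancel₀ (mul_ne_zero (ha i) (hb i))
    have hsplit := Finset.add_sum_erase univ (fun j => (a j * b j)⁻¹) (mem_univ i)
    apply pow_ne_zero 2 two_ne
    linear_combination hsplit + h1 - h3 i hi + (a i * b i)⁻¹ * hsq - 4 * hinv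
  have sq_sum : ∀ i, (a i + b i) ^ 2 = 49 := by
    intro i
    rcases hsum i with h | h | h | h
    · exact absurd (Or.inl h) (not_unit_sum i)
    · exact absurd (Or.inr h) (not_unit_sum i)
    all_goals rw [h]; norm_num
  simp only [sq_sum, ← Finset.mul_sum, h1] at h2
  have hzero : (2 : ZMod p) ^ 4 * 3 * (30 : ZMod p)⁻¹ = 0 := by
    linear_combination h2
  exact mul_ne_zero (mul_ne_zero (pow_ne_zero 4 two_ne) three_ne)
    (inv_ne_zero thirty_ne) hzero
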